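/- Let (Ω, 𝓕, P) be a probability space, let ν* > 0, let γ : Ω → [0, ∞) be bounded measurable, let C : Ω → [0, ν*] be measurable, and let N : [0, ν*] × Ω → [0, ∞) be such that for each ω the map t ↦ N(t, ω) is nondecreasing and right-continuous, N is uniformly bounded, and for each fixed s the map ω ↦ N(s, ω) is measurable. Let λ₀ : [0, ν*] → [0, ∞) be continuous with μ₀(t) = ∫₀^t λ₀(u) du satisfying μ₀(s) > 0 for every s > 0. Suppose that for every s ∈ [0, ν*], E[ N(s, ·) | σ(γ, C) ] = γ · μ₀(s) almost surely. Then for every t ∈ (0, ν*], E[ N(t ∧ C(·), ·) ] = ∫₀^t E[ 1{C ≥ s} · N(s, ·) ] · (λ₀(s)/μ₀(s)) ds, where t ∧ C denotes the minimum of t and C. -/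

import Mathlib

open MeasureTheory

theorem aux_fin {Ω : Type*} (m : MeasurableSpace Ω) {m0 : MeasurableSpace Ω} (P : Measure Ω)
    [IsProbabilityMeasure P] (hm : m ≤ m0) (a b : ℝ) (g : Ω → ℝ) (hg : Integrable g P)
    (N : ℝ → Ω → ℝ) (hN : ∀ s, Integrable (N s) P) (μ : ℝ → ℝ)
    (hcond : ∀ s ∈ Set.Icc a b, P[N s | m] =ᵐ[P] fun ω => g ω * μ s)
    (D : Ω → ℝ) (hD : Measurable[m] D) (S : Finset ℝ) (hS : ∀ ω, D ω ∈ S)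
    (hDr : ∀ ω, D ω ∈ Set.Icc a b) :
    Integrable (fun ω => N (D ω) ω) P ∧
    ∫ ω, N (D ω) ω ∂P = ∫ ω, g ω * μ (D ω) ∂P := by
  classical
  have hset : ∀ d : ℝ, MeasurableSet[m] (D ⁻¹' {d}) := fun d => hD (measurableSet_singleton d)
  have hset0 : ∀ d : ℝ, MeasurableSet (D ⁻¹' {d}) := fun d => hm _ (hset d)
  have key : ∀ F : ℝ → Ω → ℝ, (fun ω => F (D ω) ω)
      = fun ω => ∑ d ∈ S, (D ⁻¹' {d}).indicator (F d) ω := by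
    intro F
    funext ω
    rw [Finset.sum_eq_single (D ω)]
    · simp
    · intro d _ hd
      apply Set.indicator_of_notMem
      intro h
      exact hd h.symm
    · intro h
      exact absurd (hS ω) h
  have hi : ∀ d, Integrable ((D ⁻¹' {d}).indicator (N d)) P := fun d => (hN d).indicator (hset0 d)
  have hi2 : ∀ d, Integrable ((D ⁻¹' {d}).indicator (fun ω => g ω * μ d)) P :=
    fun d => (hg.mul_const _).indicator (hset0 d)
  refine ⟨?_, ?_⟩
  · rw [key N]
    exact integrable_finsetSum _ fun d _ => hi d
  · rw [key N, key (fun d ω => g ω * μ d), integral_finsetSum _ fun d _ => hi d,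
      integral_finsetSum _ fun d _ => hi2 d]
    refine Finset.sum_congr rfl fun d _ => ?_
    by_cases hd : d ∈ Set.Icc a b
    · rw [integral_indicator (hset0 d), integral_indicator (hset0 d),
        ← setIntegral_condExp hm (hN d) (hset d)]
      exact setIntegral_congr_ae (hset0 d) ((hcond d hd).mono fun ω h _ => h)
    · have : D ⁻¹' {d} = ∅ := by
        ext ω
        simp only [Set.mem_preimage, Set.mem_singleton_iff, Set.mem_empty_iff_false, iff_false]
        rintro rfl
        exact hd (hDr ω)
      simp [this]

theorem aux_lim {Ω : Type*} (m : MeasurableSpace Ω) {m0 : MeasurableSpace Ω} (P : Measure Ω)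
    [IsProbabilityMeasure P] (hm : m ≤ m0) (t : ℝ) (g : Ω → ℝ) (hg : Integrable g P)
    (N : ℝ → Ω → ℝ) (hN : ∀ s, Integrable (N s) P) (MN : ℝ) (hNb : ∀ s ω, ‖N s ω‖ ≤ MN)
    (μ : ℝ → ℝ) (hμ : Continuous μ)
    (hcond : ∀ s ∈ Set.Icc 0 t, P[N s | m] =ᵐ[P] fun ω => g ω * μ s)
    (hrc : ∀ ω, ∀ s ∈ Set.Ico 0 t, ContinuousWithinAt (fun s => N s ω) (Set.Ici s) s)
    (D : Ω → ℝ) (hD : Measurable[m] D)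
    (hDr : ∀ ω, D ω ∈ Set.Icc 0 t) :
    ∫ ω, N (D ω) ω ∂P = ∫ ω, g ω * μ (D ω) ∂P := by
  classical
  let E : ℕ → Ω → ℝ := fun n ω => min t (((⌊((n:ℝ)+1) * D ω⌋₊ : ℝ) + 1) / ((n:ℝ)+1))
  have hEm : ∀ n, Measurable[m] (E n) := by
    intro n
    have h1 : Measurable (fun x : ℝ => min t (((⌊((n:ℝ)+1) * x⌋₊ : ℝ) + 1) / ((n:ℝ)+1))) := by
      have : Measurable (fun x : ℝ => ⌊((n:ℝ)+1) * x⌋₊) :=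
        Nat.measurable_floor.comp (measurable_const.mul measurable_id)
      have h2 : Measurable (fun x : ℝ => ((⌊((n:ℝ)+1) * x⌋₊ : ℕ) : ℝ)) :=
        measurable_from_nat.comp this
      exact measurable_const.min ((h2.add_const _).div_const _)
    exact h1.comp hD
  have hlow : ∀ n ω, D ω ≤ E n ω := by
    intro n ω
    refine le_min (hDr ω).2 ?_
    have hp : (0:ℝ) < (n:ℝ)+1 := by positivity
    rw [le_div_iff₀ hp, mul_comm]
    exact (Nat.lt_floor_add_one _).le
  have hup : ∀ n ω, E n ω ≤ D ω + 1 / ((n:ℝ)+1) := by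
    intro n ω
    refine (min_le_right _ _).trans ?_
    have hp : (0:ℝ) < (n:ℝ)+1 := by positivity
    have h1 : (D ω + 1 / ((n:ℝ)+1)) * ((n:ℝ)+1) = ((n:ℝ)+1) * D ω + 1 := by
      field_simp
    rw [div_le_iff₀ hp, h1]
    have := Nat.floor_le (mul_nonneg hp.le (hDr ω).1)
    linarith
  have hEr : ∀ n ω, E n ω ∈ Set.Icc 0 t := fun n ω =>
    ⟨(hDr ω).1.trans (hlow n ω), min_le_left _ _⟩
  have hElim : ∀ ω, Filter.Tendsto (fun n => E n ω) Filter.atTop (nhds (D ω)) := by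
    intro ω
    refine tendsto_of_tendsto_of_tendsto_of_le_of_le tendsto_const_nhds ?_
      (fun n => hlow n ω) (fun n => hup n ω)
    simpa using (tendsto_const_nhds (x := D ω)).add (tendsto_one_div_add_atTop_nhds_zero_nat (𝕜 := ℝ))
  have hfin : ∀ n, Integrable (fun ω => N (E n ω) ω) P ∧
      ∫ ω, N (E n ω) ω ∂P = ∫ ω, g ω * μ (E n ω) ∂P := by
    intro n
    refine aux_fin m P hm 0 t g hg N hN μ hcond (E n) (hEm n)
      ((Finset.range (⌊((n:ℝ)+1) * t⌋₊ + 1)).image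
        (fun k : ℕ => min t (((k:ℝ) + 1) / ((n:ℝ)+1)))) ?_ (hEr n)
    intro ω
    refine Finset.mem_image.2 ⟨⌊((n:ℝ)+1) * D ω⌋₊, ?_, rfl⟩
    rw [Finset.mem_range, Nat.lt_succ_iff]
    exact Nat.floor_mono (mul_le_mul_of_nonneg_left (hDr ω).2 (by positivity))
  obtain ⟨K, hK⟩ := (isCompact_Icc (a := (0:ℝ)) (b := t)).exists_bound_of_continuousOn
    hμ.continuousOn
  have L1 : Filter.Tendsto (fun n => ∫ ω, N (E n ω) ω ∂P) Filter.atTop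
      (nhds (∫ ω, N (D ω) ω ∂P)) := by
    refine tendsto_integral_of_dominated_convergence (fun _ => MN)
      (fun n => (hfin n).1.aestronglyMeasurable) (integrable_const _)
      (fun n => Filter.Eventually.of_forall fun ω => hNb _ _)
      (Filter.Eventually.of_forall fun ω => ?_)
    rcases eq_or_lt_of_le (hDr ω).2 with h | h
    · have : ∀ n, E n ω = D ω := fun n => le_antisymm ((hEr n ω).2.trans h.ge) (hlow n ω)
      simp only [this]
      exact tendsto_const_nhds
    · have hc := hrc ω (D ω) ⟨(hDr ω).1, h⟩
      exact hc.tendsto.comp (tendsto_nhdsWithin_iff.2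
        ⟨hElim ω, Filter.Eventually.of_forall fun n => hlow n ω⟩)
  have L2 : Filter.Tendsto (fun n => ∫ ω, g ω * μ (E n ω) ∂P) Filter.atTop
      (nhds (∫ ω, g ω * μ (D ω) ∂P)) := by
    refine tendsto_integral_of_dominated_convergence (fun ω => ‖g ω‖ * K)
      (fun n => hg.aestronglyMeasurable.mul
        (hμ.measurable.comp ((hEm n).mono hm le_rfl)).aestronglyMeasurable)
      (hg.norm.mul_const _)
      (fun n => Filter.Eventually.of_forall fun ω => ?_)
      (Filter.Eventually.of_forall fun ω => ?_)
    · rw [norm_mul]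
      exact mul_le_mul_of_nonneg_left (hK _ (hEr n ω)) (norm_nonneg _)
    · exact tendsto_const_nhds.mul ((hμ.tendsto _).comp (hElim ω))
  have : (fun n => ∫ ω, N (E n ω) ω ∂P) = fun n => ∫ ω, g ω * μ (E n ω) ∂P :=
    funext fun n => (hfin n).2
  rw [this] at L1
  exact tendsto_nhds_unique L1 L2

theorem aux_fubini {Ω : Type*} [MeasurableSpace Ω] (P : Measure Ω) [IsProbabilityMeasure P]
    (g : Ω → ℝ) (hg : Integrable g P) (C : Ω → ℝ) (hC : Measurable C) (hC0 : ∀ ω, 0 ≤ C ω)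
    (l : ℝ → ℝ) (hl : Continuous l) (t : ℝ) (ht : 0 ≤ t) :
    ∫ s in (0:ℝ)..t, (∫ ω, (if s ≤ C ω then (1:ℝ) else 0) * g ω ∂P) * l s
      = ∫ ω, g ω * (∫ u in (0:ℝ)..(min t (C ω)), l u) ∂P := by
  have hlI : Integrable l (volume.restrict (Set.Ioc 0 t)) :=
    (hl.continuousOn.integrableOn_compact isCompact_Icc).mono_set Set.Ioc_subset_Icc_self
  have hms : MeasurableSet {p : ℝ × Ω | p.1 ≤ C p.2} :=
    measurableSet_le measurable_fst (hC.comp measurable_snd)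
  have hI : Integrable (Function.uncurry fun (s : ℝ) (ω : Ω) =>
      (if s ≤ C ω then (1:ℝ) else 0) * g ω * l s) ((volume.restrict (Set.Ioc 0 t)).prod P) := by
    have h := (hlI.mul_prod hg).indicator hms
    refine h.congr (Filter.Eventually.of_forall fun p => ?_)
    by_cases hp : p.1 ≤ C p.2
    · simp [Function.uncurry, Set.indicator, hp, mul_comm]
    · simp [Function.uncurry, Set.indicator, hp]
  rw [intervalIntegral.integral_of_le ht]
  simp_rw [← integral_mul_const]
  rw [integral_integral_swap hI]
  refine integral_congr_ae (Filter.Eventually.of_forall fun ω => ?_)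
  simp only
  rw [intervalIntegral.integral_of_le (le_min ht (hC0 ω)), ← Set.Ioc_inter_Iic,
    ← integral_const_mul, ← setIntegral_indicator measurableSet_Iic]
  refine integral_congr_ae (Filter.Eventually.of_forall fun s => ?_)
  by_cases hp : s ≤ C ω <;> simp [Set.indicator, hp]

theorem aux_main {Ω : Type*} (m : MeasurableSpace Ω) {m0 : MeasurableSpace Ω} (P : Measure Ω) [IsProbabilityMeasure P]
    (hm : m ≤ m0) (νstar : ℝ) (hν : 0 < νstar)
    (γ : Ω → ℝ) (hγ : Measurable γ) (hγ0 : ∀ ω, 0 ≤ γ ω) (Mγ : ℝ) (hγbd : ∀ ω, γ ω ≤ Mγ)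
    (C : Ω → ℝ) (hC : Measurable C) (hCm : Measurable[m] C) (hCrange : ∀ ω, C ω ∈ Set.Icc 0 νstar)
    (N : ℝ → Ω → ℝ)
    (hNmono : ∀ ω, MonotoneOn (fun t => N t ω) (Set.Icc 0 νstar))
    (hNrc : ∀ ω, ∀ t ∈ Set.Ico 0 νstar,
      ContinuousWithinAt (fun s => N s ω) (Set.Ici t) t)
    (hN0 : ∀ t ω, 0 ≤ N t ω) (MN : ℝ) (hNbd : ∀ t ω, N t ω ≤ MN)
    (hNmeas : ∀ s, Measurable (N s))
    (lam₀ : ℝ → ℝ) (hlamcont : ContinuousOn lam₀ (Set.Icc 0 νstar))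
    (hlam0 : ∀ s ∈ Set.Icc 0 νstar, 0 ≤ lam₀ s)
    (hμpos : ∀ s ∈ Set.Ioc 0 νstar, 0 < ∫ u in (0:ℝ)..s, lam₀ u)
    (hcond : ∀ s ∈ Set.Icc 0 νstar,
      P[N s | m]
        =ᵐ[P] fun ω => γ ω * ∫ u in (0:ℝ)..s, lam₀ u) :
    ∀ t ∈ Set.Ioc 0 νstar,
      ∫ ω, N (min t (C ω)) ω ∂P =
        ∫ s in (0:ℝ)..t,
          (∫ ω, (if s ≤ C ω then (1:ℝ) else 0) * N s ω ∂P) *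
            (lam₀ s / ∫ u in (0:ℝ)..s, lam₀ u) := by
  intro t ht
  let l : ℝ → ℝ := Set.IccExtend hν.le ((Set.Icc 0 νstar).domRestrict lam₀)
  have hl : Continuous l := (continuousOn_iff_continuous_domRestrict.1 hlamcont).Icc_extend'
  have hll : ∀ s ∈ Set.Icc 0 νstar, l s = lam₀ s := fun s hs => by
    simp only [l, Set.IccExtend_of_mem hν.le _ hs]
    rfl
  have hμ : ∀ s ∈ Set.Icc 0 νstar, ∫ u in (0:ℝ)..s, lam₀ u = ∫ u in (0:ℝ)..s, l u := by
    intro s hs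
    refine intervalIntegral.integral_congr fun u hu => ?_
    rw [Set.uIcc_of_le hs.1] at hu
    exact (hll u ⟨hu.1, hu.2.trans hs.2⟩).symm
  have hμc : Continuous (fun s => ∫ u in (0:ℝ)..s, l u) :=
    intervalIntegral.continuous_primitive (fun a b => hl.intervalIntegrable a b) 0
  have hNb : ∀ s ω, ‖N s ω‖ ≤ MN := fun s ω => by
    rw [Real.norm_of_nonneg (hN0 s ω)]
    exact hNbd s ω
  have hNi : ∀ s, Integrable (N s) P := fun s =>
    Integrable.of_bound (hNmeas s).aestronglyMeasurable MN (Filter.Eventually.of_forall (hNb s))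
  have hγi : Integrable γ P :=
    Integrable.of_bound hγ.aestronglyMeasurable Mγ (Filter.Eventually.of_forall fun ω => by
      rw [Real.norm_of_nonneg (hγ0 ω)]
      exact hγbd ω)
  have hLHS := aux_lim m P hm t γ hγi N hNi MN hNb (fun s => ∫ u in (0:ℝ)..s, l u) hμc
    (fun s hs => by
      have hs' : s ∈ Set.Icc 0 νstar := ⟨hs.1, hs.2.trans ht.2⟩
      have h := hcond s hs'
      rw [hμ s hs'] at h
      exact h)
    (fun ω s hs => hNrc ω s ⟨hs.1, hs.2.trans_le ht.2⟩)
    (fun ω => min t (C ω)) (measurable_const.min hCm)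
    (fun ω => ⟨le_min ht.1.le (hCrange ω).1, min_le_left _ _⟩)
  rw [hLHS, ← aux_fubini P γ hγi C hC (fun ω => (hCrange ω).1) l hl t ht.1.le,
    intervalIntegral.integral_of_le ht.1.le, intervalIntegral.integral_of_le ht.1.le]
  refine setIntegral_congr_fun measurableSet_Ioc fun s hs => ?_
  have hs1 : s ∈ Set.Ioc 0 νstar := ⟨hs.1, hs.2.trans ht.2⟩
  have hs2 : s ∈ Set.Icc 0 νstar := Set.Ioc_subset_Icc_self hs1
  have hAm : MeasurableSet[m] {ω | s ≤ C ω} := hCm measurableSet_Ici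
  have hA := hm _ hAm
  have hind : ∀ f : Ω → ℝ, ∫ ω, (if s ≤ C ω then (1:ℝ) else 0) * f ω ∂P
      = ∫ ω in {ω | s ≤ C ω}, f ω ∂P := by
    intro f
    rw [← integral_indicator hA]
    refine integral_congr_ae (Filter.Eventually.of_forall fun ω => ?_)
    by_cases hp : s ≤ C ω <;> simp [Set.indicator, hp]
  have hcs : ∫ ω in {ω | s ≤ C ω}, N s ω ∂P
      = (∫ ω in {ω | s ≤ C ω}, γ ω ∂P) * ∫ u in (0:ℝ)..s, lam₀ u := by
    rw [← setIntegral_condExp hm (hNi s) hAm, ← integral_mul_const]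
    exact setIntegral_congr_ae hA ((hcond s hs2).mono fun ω h _ => h)
  have hne := (hμpos s hs1).ne'
  rw [hind, hind, hcs, hll s hs2]
  field_simp

/-- The identity `E{dM(t)} = 0` in integrated form: if
`E[N(s) | σ(γ, C)] = γ μ₀(s)` a.s. for every `s ∈ [0, ν*]`, then for every `t ∈ (0, ν*]`,
`E[N(t ∧ C)] = ∫₀^t E[1{C ≥ s} N(s)] (λ₀(s)/μ₀(s)) ds`, where `μ₀(t) = ∫₀^t λ₀`. -/
theorem stmt5 {Ω : Type*} [MeasurableSpace Ω] (P : Measure Ω) [IsProbabilityMeasure P]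
    (νstar : ℝ) (hν : 0 < νstar)
    (γ : Ω → ℝ) (hγ : Measurable γ) (hγ0 : ∀ ω, 0 ≤ γ ω) (Mγ : ℝ) (hγbd : ∀ ω, γ ω ≤ Mγ)
    (C : Ω → ℝ) (hC : Measurable C) (hCrange : ∀ ω, C ω ∈ Set.Icc 0 νstar)
    (N : ℝ → Ω → ℝ)
    (hNmono : ∀ ω, MonotoneOn (fun t => N t ω) (Set.Icc 0 νstar))
    (hNrc : ∀ ω, ∀ t ∈ Set.Ico 0 νstar,
      ContinuousWithinAt (fun s => N s ω) (Set.Ici t) t)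
    (hN0 : ∀ t ω, 0 ≤ N t ω) (MN : ℝ) (hNbd : ∀ t ω, N t ω ≤ MN)
    (hNmeas : ∀ s, Measurable (N s))
    (lam₀ : ℝ → ℝ) (hlamcont : ContinuousOn lam₀ (Set.Icc 0 νstar))
    (hlam0 : ∀ s ∈ Set.Icc 0 νstar, 0 ≤ lam₀ s)
    (hμpos : ∀ s ∈ Set.Ioc 0 νstar, 0 < ∫ u in (0:ℝ)..s, lam₀ u)
    (hcond : ∀ s ∈ Set.Icc 0 νstar,
      P[N s | MeasurableSpace.comap (fun ω => (γ ω, C ω)) inferInstance]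
        =ᵐ[P] fun ω => γ ω * ∫ u in (0:ℝ)..s, lam₀ u) :
    ∀ t ∈ Set.Ioc 0 νstar,
      ∫ ω, N (min t (C ω)) ω ∂P =
        ∫ s in (0:ℝ)..t,
          (∫ ω, (if s ≤ C ω then (1:ℝ) else 0) * N s ω ∂P) *
            (lam₀ s / ∫ u in (0:ℝ)..s, lam₀ u) := by
  have hm := (hγ.prodMk hC).comap_le
  refine aux_main _ P hm νstar hν γ hγ hγ0 Mγ hγbd C hC ?_ hCrange N hNmono hNrc hN0 MN hNbd hNmeas
    lam₀ hlamcont hlam0 hμpos hcond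
  exact measurable_snd.comp (comap_measurable (fun ω => (γ ω, C ω)))
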